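/- arXiv:1805.07503 — 7 statements merged into one kernel-verified Lean document; each statement's English description precedes it below -/
import Mathlib

section
/- Let (X,d) be a connected compact metric space containing at least two points, and let f_n : X → X be a sequence of continuous nonwandering maps converging uniformly to a map f : X → X. If the sequence (f_n) has the uniform shadowing property, then f has positive topological entropy. -/
open Filter Topology Set
open scoped ENNReal

variable {X : Type*}

/-- A sequence `(x i)` is a `δ`-pseudo-orbit for `f` if `dist (f (x i)) (x (i+1)) < δ`
for every `i ≥ 0`. -/
def IsPseudoOrbit [MetricSpace X] (f : X → X) (δ : ℝ) (x : ℕ → X) : Prop :=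
  ∀ i : ℕ, dist (f (x i)) (x (i + 1)) < δ

/-- A sequence `(x i)` is `ε`-shadowed by the point `y`. -/
def IsShadowedBy [MetricSpace X] (f : X → X) (ε : ℝ) (x : ℕ → X) (y : X) : Prop :=
  ∀ i : ℕ, dist (f^[i] y) (x i) < ε

/-- A point `x₀` is shadowable: for every `ε > 0` there is `δ > 0` such that every
`δ`-pseudo-orbit starting at `x₀` is `ε`-shadowed by some point. -/
def ShadowablePoint [MetricSpace X] (f : X → X) (x₀ : X) : Prop :=
  ∀ ε > (0 : ℝ), ∃ δ > (0 : ℝ), ∀ x : ℕ → X, IsPseudoOrbit f δ x → x 0 = x₀ →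
    ∃ y : X, IsShadowedBy f ε x y

/-- `f` has the shadowing property. -/
def ShadowingProperty [MetricSpace X] (f : X → X) : Prop :=
  ∀ ε > (0 : ℝ), ∃ δ > (0 : ℝ), ∀ x : ℕ → X, IsPseudoOrbit f δ x →
    ∃ y : X, IsShadowedBy f ε x y

/-- A sequence of maps `F n` has the uniform shadowing property: each `F n` has the shadowing
property and, for every `ε > 0`, one single `δ > 0` works for all the maps `F n`. -/
def UniformShadowing [MetricSpace X] (F : ℕ → X → X) : Prop :=
  (∀ n, ShadowingProperty (F n)) ∧
    ∀ ε > (0 : ℝ), ∃ δ > (0 : ℝ), ∀ n, ∀ x : ℕ → X, IsPseudoOrbit (F n) δ x →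
      ∃ y : X, IsShadowedBy (F n) ε x y

/-- A point `x` is nonwandering for `f` if every neighborhood `U` of `x` satisfies
`f^n(U) ∩ U ≠ ∅` for some `n ≥ 1`. -/
def NonwanderingPt [MetricSpace X] (f : X → X) (x : X) : Prop :=
  ∀ U ∈ 𝓝 x, ∃ n : ℕ, 1 ≤ n ∧ (f^[n] '' U ∩ U).Nonempty

/-- `s_n(V, ε)`: the maximal cardinality of an `(n, ε)`-separated subset of `V`. -/
noncomputable def sepNum [MetricSpace X] (f : X → X) (V : Set X) (n : ℕ) (ε : ℝ) : ℕ :=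
  sSup {k : ℕ | ∃ E : Finset X, ↑E ⊆ V ∧ E.card = k ∧
    ∀ x ∈ E, ∀ y ∈ E, x ≠ y → ∃ i ≤ n, ε ≤ dist (f^[i] x) (f^[i] y)}

/-- `lim_{ε → 0} limsup_{n → ∞} (1/n) log s_n(V, ε)`, as a supremum over `ε > 0`
(the inner quantity is monotone as `ε` decreases). -/
noncomputable def entropyWithin [MetricSpace X] (f : X → X) (V : Set X) : ℝ≥0∞ :=
  ⨆ (ε : ℝ) (_ : 0 < ε),
    Filter.limsup (fun n : ℕ => ENNReal.ofReal (Real.log (sepNum f V n ε) / n)) Filter.atTop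

/-- The topological entropy of `f`. -/
noncomputable def topEntropy [MetricSpace X] (f : X → X) : ℝ≥0∞ :=
  entropyWithin f Set.univ

/-- `y` is reached from `x` by a `δ`-chain of length `n` for `f`. -/
def HasChain [MetricSpace X] (f : X → X) (δ : ℝ) (n : ℕ) (x y : X) : Prop :=
  ∃ c : ℕ → X, c 0 = x ∧ c n = y ∧ ∀ i < n, dist (f (c i)) (c (i + 1)) < δ

namespace HasChain

variable [MetricSpace X] {f : X → X} {δ η : ℝ} {m n : ℕ} {x y z : X}

lemma append (h₁ : HasChain f δ m x y) (h₂ : HasChain f δ n y z) :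
    HasChain f δ (m + n) x z := by
  obtain ⟨c, c0, cm, hc⟩ := h₁
  obtain ⟨e, e0, en, he⟩ := h₂
  refine ⟨fun i => if i < m then c i else e (i - m), ?_, by simp [en], fun i hi => ?_⟩
  · rcases Nat.eq_zero_or_pos m with rfl | hm
    · simp [e0, ← cm, c0]
    · simp [hm, c0]
  · rcases lt_trichotomy (i + 1) m with h | h | h
    · simpa [h, show i < m by omega] using hc i (by omega)
    · have := hc i (by omega)
      simpa [h, show i < m by omega, e0, ← cm] using this
    · have := he (i - m) (by omega)
      rw [show i - m + 1 = i + 1 - m by omega] at this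
      simpa [show ¬ i < m by omega, show ¬ i + 1 < m by omega] using this

lemma refl_zero (x : X) : HasChain f δ 0 x x :=
  ⟨fun _ => x, rfl, rfl, by simp⟩

lemma nsmul_loop (h : HasChain f δ n x x) (k : ℕ) : HasChain f δ (k * n) x x := by
  induction k with
  | zero => simpa using refl_zero x
  | succ k ih => rw [Nat.succ_mul]; exact ih.append h

/-- Pad a chain with a loop at its end so that its length gets multiplied by `k`. -/
lemma mul_length (h : HasChain f δ n x y) (hy : HasChain f δ n y y) {k : ℕ} (hk : 0 < k) :
    HasChain f δ (k * n) x y := by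
  obtain ⟨k, rfl⟩ : ∃ l, k = l + 1 := ⟨k - 1, by omega⟩
  rw [Nat.succ_mul, add_comm]
  exact h.append (hy.nsmul_loop k)

lemma change_end (h : HasChain f δ n x y) (hn : 0 < n) (hz : dist y z < η) :
    HasChain f (δ + η) n x z := by
  obtain ⟨c, c0, cn, hc⟩ := h
  have hη : 0 < η := dist_nonneg.trans_lt hz
  refine ⟨Function.update c n z, ?_, by simp, fun i hi => ?_⟩
  · rw [Function.update_of_ne hn.ne, c0]
  · rw [Function.update_of_ne hi.ne]
    by_cases h : i + 1 = n
    · subst h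
      have := dist_triangle (f (c i)) (c (i + 1)) z
      have := hc i hi
      rw [cn] at *
      simp only [Function.update_self]
      linarith
    · rw [Function.update_of_ne h]
      linarith [hc i hi]

lemma change_start (h : HasChain f δ n x y) (hn : 0 < n) (hz : dist (f z) (f x) < η) :
    HasChain f (δ + η) n z y := by
  obtain ⟨c, c0, cn, hc⟩ := h
  have hη : 0 < η := dist_nonneg.trans_lt hz
  refine ⟨Function.update c 0 z, by simp, ?_, fun i hi => ?_⟩
  · rw [Function.update_of_ne hn.ne', cn]
  · rw [Function.update_of_ne i.succ_ne_zero]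
    by_cases h : i = 0
    · subst h
      have := dist_triangle (f z) (f x) (c (0 + 1))
      have := hc 0 hi
      rw [c0] at *
      simp only [Function.update_self]
      linarith
    · rw [Function.update_of_ne h]
      linarith [hc i hi]

lemma iterate {g : X → X} (hg : ∀ x, dist (f x) (g x) < δ) (n : ℕ) (x : X) :
    HasChain f δ n x (g^[n] x) :=
  ⟨fun i => g^[i] x, rfl, rfl, fun i _ => by
    simpa only [Function.iterate_succ_apply'] using hg _⟩

end HasChain

/-- A uniform limit of nonwandering maps is chain recurrent. -/
lemma exists_hasChain_self [MetricSpace X] {F : ℕ → X → X}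
    (hnw : ∀ n, ∀ x : X, NonwanderingPt (F n) x) {f : X → X} (hf : Continuous f)
    (hconv : TendstoUniformly F f atTop) {δ : ℝ} (hδ : 0 < δ) (x : X) :
    ∃ n, 0 < n ∧ HasChain f δ n x x := by
  have h3 : 0 < δ / 3 := by positivity
  obtain ⟨k, hk⟩ := (Metric.tendstoUniformly_iff.1 hconv (δ / 3) h3).exists
  have hU : f ⁻¹' Metric.ball (f x) (δ / 3) ∩ Metric.ball x (δ / 3) ∈ 𝓝 x :=
    inter_mem (hf.continuousAt (Metric.ball_mem_nhds _ h3)) (Metric.ball_mem_nhds _ h3)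
  obtain ⟨n, hn, _, ⟨u, hu, rfl⟩, hv⟩ := hnw k x _ hU
  refine ⟨n, hn, ?_⟩
  have := ((HasChain.iterate hk n u).change_end hn hv.2).change_start hn
    (z := x) (η := δ / 3) (by simpa [dist_comm] using hu.1)
  rwa [show δ / 3 + δ / 3 + δ / 3 = δ by ring] at this

/-- In a connected space, chain recurrence provides, for any two points, chains of one common
length between all four ordered pairs formed from them. -/
lemma exists_common_chain_length [MetricSpace X] [ConnectedSpace X] {f : X → X}
    (hrec : ∀ δ > (0 : ℝ), ∀ x, ∃ n, 0 < n ∧ HasChain f δ n x x) {δ : ℝ} (hδ : 0 < δ)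
    (x y : X) :
    ∃ n, 0 < n ∧ HasChain f δ n x x ∧ HasChain f δ n x y ∧ HasChain f δ n y x ∧
      HasChain f δ n y y := by
  have h2 : 0 < δ / 2 := by positivity
  have hsymm : Std.Symm fun x y => ∃ n, 0 < n ∧ HasChain f δ n x x ∧
      HasChain f δ n x y ∧ HasChain f δ n y x ∧ HasChain f δ n y y :=
    ⟨fun x y ⟨n, hn, xx, xy, yx, yy⟩ => ⟨n, hn, yy, yx, xy, xx⟩⟩
  refine PreconnectedSpace.induction₂ (fun x y => ∃ n, 0 < n ∧ HasChain f δ n x x ∧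
    HasChain f δ n x y ∧ HasChain f δ n y x ∧ HasChain f δ n y y) ?_ ⟨?_⟩ x y
  · intro x
    filter_upwards [Metric.ball_mem_nhds x h2] with y hy
    obtain ⟨m, hm, hx⟩ := hrec (δ / 2) h2 x
    obtain ⟨n, hn, hy'⟩ := hrec (δ / 2) h2 y
    have hpos : 0 < m * n := Nat.mul_pos hm hn
    have hX := hx.nsmul_loop n
    rw [mul_comm] at hX
    have hY := hy'.nsmul_loop m
    have key : ∀ {a b : X}, HasChain f (δ / 2) (m * n) a a → dist a b < δ / 2 →
        HasChain f δ (m * n) a b := fun h hab => by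
      simpa using h.change_end hpos hab
    exact ⟨m * n, hpos, key hX (by simpa), key hX (by rwa [dist_comm]), key hY hy,
      key hY (by simpa)⟩
  · rintro x y z ⟨m, hm, xx₀, xy, yx, yy⟩ ⟨n, hn, yy', yz, zy, zz⟩
    have xx := xx₀.mul_length xx₀ hn
    have xy := xy.mul_length yy hn
    have yx := yx.mul_length xx₀ hn
    have yz := yz.mul_length zz hm
    have zy := zy.mul_length yy' hm
    have zz := zz.mul_length zz hm
    rw [mul_comm n m] at xx xy yx
    have hpos := Nat.mul_pos hm hn
    exact ⟨m * n + m * n, by omega, xx.append xx, xy.append yz, zy.append yx, zz.append zz⟩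

/-- A uniform limit of maps with the uniform shadowing property has the shadowing property. -/
lemma UniformShadowing.shadowingProperty_of_tendstoUniformly [MetricSpace X] [CompactSpace X]
    {F : ℕ → X → X} (hus : UniformShadowing F) {f : X → X} (hf : Continuous f)
    (hconv : TendstoUniformly F f atTop) : ShadowingProperty f := by
  intro ε hε
  obtain ⟨δ, hδ, h⟩ := hus.2 (ε / 2) (by positivity)
  refine ⟨δ / 2, by positivity, fun x hx => ?_⟩
  obtain ⟨N, hN⟩ := eventually_atTop.1
    (Metric.tendstoUniformly_iff.1 hconv (δ / 2) (by positivity))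
  have hps : ∀ n, IsPseudoOrbit (F (n + N)) δ x := fun n i => by
    have h₁ := hN (n + N) (by omega) (x i)
    have h₂ := dist_triangle_left (F (n + N) (x i)) (x (i + 1)) (f (x i))
    have h₃ := hx i
    linarith
  choose y hy using fun n => h (n + N) x (hps n)
  obtain ⟨z, φ, hφ, hz⟩ := CompactSpace.tendsto_subseq y
  have hshift : Tendsto (fun n => φ n + N) atTop atTop :=
    (tendsto_add_atTop_nat N).comp hφ.tendsto_atTop
  have hlim : ∀ i, Tendsto (fun n => (F (φ n + N))^[i] (y (φ n))) atTop (𝓝 (f^[i] z)) := by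
    intro i
    induction i with
    | zero => exact hz
    | succ i ih =>
      simp only [Function.iterate_succ_apply']
      have hsub : TendstoUniformly (fun n => F (φ n + N)) f atTop := fun u hu =>
        hshift.eventually (hconv u hu)
      exact hsub.tendsto_comp hf.continuousAt ih
  refine ⟨z, fun i => ?_⟩
  have : dist (f^[i] z) (x i) ≤ ε / 2 :=
    le_of_tendsto ((hlim i).dist tendsto_const_nhds)
      (Eventually.of_forall fun n => (hy (φ n) i).le)
  linarith

lemma bddAbove_card_separated [MetricSpace X] [CompactSpace X] {f : X → X}
    (hf : Continuous f) (V : Set X) (n : ℕ) {ε : ℝ} (hε : 0 < ε) :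
    BddAbove {k : ℕ | ∃ E : Finset X, ↑E ⊆ V ∧ E.card = k ∧
      ∀ x ∈ E, ∀ y ∈ E, x ≠ y → ∃ i ≤ n, ε ≤ dist (f^[i] x) (f^[i] y)} := by
  have hU : ∀ x : X, {y | ∀ i ∈ Finset.range (n + 1), dist (f^[i] y) (f^[i] x) < ε / 2} ∈ 𝓝 x :=
    fun x => (Filter.eventually_all_finset _).2 fun i _ =>
      (hf.iterate i).continuousAt (Metric.ball_mem_nhds _ (by positivity))
  obtain ⟨t, ht⟩ := finite_cover_nhds hU
  refine ⟨t.card, ?_⟩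
  rintro _ ⟨E, -, rfl, hE⟩
  have hcov : ∀ y : X, ∃ x ∈ t, ∀ i ∈ Finset.range (n + 1), dist (f^[i] y) (f^[i] x) < ε / 2 :=
    fun y => by simpa using ht.ge (mem_univ y)
  choose g hgt hg using hcov
  refine Finset.card_le_card_of_injOn g (fun y _ => hgt y) fun x hx y hy hxy => ?_
  by_contra hne
  obtain ⟨i, hi, hd⟩ := hE x hx y hy hne
  have h₁ := hg x i (by simp; omega)
  have h₂ := hg y i (by simp; omega)
  rw [← hxy] at h₂
  have := dist_triangle_right (f^[i] x) (f^[i] y) (f^[i] (g x))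
  linarith

/-- With shadowing, chains of one common length between two points `p false` and `p true` yield
exponentially many separated orbits. -/
lemma two_pow_le_sepNum [MetricSpace X] [CompactSpace X] {f : X → X} (hf : Continuous f)
    {ε δ : ℝ} (hε : 0 < ε)
    (hsh : ∀ x : ℕ → X, IsPseudoOrbit f δ x → ∃ y : X, IsShadowedBy f ε x y)
    {p : Bool → X} (hp : ∀ s t, s ≠ t → 3 * ε ≤ dist (p s) (p t)) {N : ℕ} (hN : 0 < N)
    (hchain : ∀ s t, HasChain f δ N (p s) (p t)) (k : ℕ) :
    2 ^ k ≤ sepNum f univ (k * N) ε := by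
  classical
  choose c c0 cN hc using hchain
  have hword : ∀ w : ℕ → Bool, ∃ y : X, ∀ j, dist (f^[j * N] y) (p (w j)) < ε := by
    intro w
    obtain ⟨y, hy⟩ := hsh (fun i => c (w (i / N)) (w (i / N + 1)) (i % N)) fun i => by
      have hlt := Nat.mod_lt i hN
      have := hc (w (i / N)) (w (i / N + 1)) (i % N) hlt
      have hi := Nat.div_add_mod i N
      rcases Nat.lt_or_ge (i % N + 1) N with h | h
      · have h₁ : (i + 1) / N = i / N := by
          rw [← hi, add_assoc, Nat.mul_add_div hN, Nat.div_eq_of_lt h, Nat.mul_add_div hN,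
            Nat.div_eq_of_lt hlt]
        have h₂ : (i + 1) % N = i % N + 1 := by
          have := Nat.div_add_mod (i + 1) N
          rw [h₁] at this; omega
        simpa only [h₁, h₂] using this
      · have h' : i % N + 1 = N := by omega
        have hi' : i + 1 = (i / N + 1) * N := by nlinarith
        have h₁ : (i + 1) / N = i / N + 1 := by rw [hi', Nat.mul_div_cancel _ hN]
        have h₂ : (i + 1) % N = 0 := by rw [hi', Nat.mul_mod_left]
        rw [h', cN] at this
        simpa only [h₁, h₂, c0] using this
    refine ⟨y, fun j => ?_⟩
    have := hy (j * N)
    simpa only [Nat.mul_div_cancel _ hN, Nat.mul_mod_left, c0] using this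
  choose y hy using fun w : Fin k → Bool =>
    hword fun j => if h : j < k then w ⟨j, h⟩ else false
  have hsep : ∀ v w, v ≠ w → ∃ i ≤ k * N, ε ≤ dist (f^[i] (y v)) (f^[i] (y w)) := by
    intro v w hvw
    obtain ⟨j, hj⟩ := Function.ne_iff.1 hvw
    refine ⟨j * N, Nat.mul_le_mul_right _ j.2.le, ?_⟩
    have h₁ := hy v j
    have h₂ := hy w j
    simp only [j.2, dite_true, Fin.eta] at h₁ h₂
    have h₃ := hp _ _ hj
    have h₄ := dist_triangle4_left (f^[j * N] (y v)) (f^[j * N] (y w)) (p (v j)) (p (w j))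
    linarith
  have hinj : Function.Injective y := by
    intro v w hvw
    by_contra hne
    obtain ⟨i, -, hi⟩ := hsep v w hne
    rw [hvw, dist_self] at hi
    linarith
  refine le_csSup (bddAbove_card_separated hf univ (k * N) hε)
    ⟨Finset.univ.image y, subset_univ _, ?_, ?_⟩
  · simp [Finset.card_image_of_injective _ hinj]
  · simp only [Finset.mem_image, Finset.mem_univ, true_and]
    rintro _ ⟨v, rfl⟩ _ ⟨w, rfl⟩ hne
    exact hsep v w fun h => hne (by rw [h])

lemma topEntropy_pos_of_two_pow_le_sepNum [MetricSpace X] {f : X → X} {ε : ℝ} (hε : 0 < ε)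
    {N : ℕ} (hN : 0 < N) (h : ∀ k, 2 ^ k ≤ sepNum f univ (k * N) ε) : 0 < topEntropy f := by
  have hlog : 0 < Real.log 2 / N := div_pos (Real.log_pos one_lt_two) (by exact_mod_cast hN)
  refine (ENNReal.ofReal_pos.2 hlog).trans_le (le_trans ?_
    (le_iSup₂_of_le (f := fun (ε : ℝ) (_ : 0 < ε) => Filter.limsup (fun n : ℕ =>
      ENNReal.ofReal (Real.log (sepNum f univ n ε) / n)) Filter.atTop) ε hε le_rfl))
  refine le_limsup_of_frequently_le (frequently_atTop.2 fun m => ?_) (by isBoundedDefault)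
  refine ⟨(m + 1) * N, by nlinarith, ENNReal.ofReal_le_ofReal ?_⟩
  have hN' : (0 : ℝ) < N := by exact_mod_cast hN
  have hle : Real.log ((2 : ℝ) ^ (m + 1)) ≤ Real.log (sepNum f univ ((m + 1) * N) ε) :=
    Real.log_le_log (by positivity) (by exact_mod_cast h (m + 1))
  rw [Real.log_pow] at hle
  calc Real.log 2 / N = ((m + 1 : ℕ) * Real.log 2) / ((m + 1) * N : ℕ) := by
        push_cast; field_simp
    _ ≤ _ := by gcongr

/-- Theorem: if `X` is a connected compact metric space with at least two points and `f` is the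
uniform limit of nonwandering maps with the uniform shadowing property, then `f` has positive
topological entropy. -/
theorem stmt3 [MetricSpace X] [CompactSpace X] [ConnectedSpace X] [Nontrivial X]
    (F : ℕ → X → X) (hc : ∀ n, Continuous (F n))
    (hnw : ∀ n, ∀ x : X, NonwanderingPt (F n) x)
    (f : X → X) (hconv : TendstoUniformly F f atTop)
    (hus : UniformShadowing F) :
    0 < topEntropy f := by
  have hf : Continuous f := hconv.continuous (Frequently.of_forall hc)
  obtain ⟨a, b, hab⟩ := exists_pair_ne X
  have hε : 0 < dist a b / 3 := div_pos (dist_pos.2 hab) three_pos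
  obtain ⟨δ, hδ, hsh⟩ := hus.shadowingProperty_of_tendstoUniformly hf hconv _ hε
  obtain ⟨N, hN, haa, hab', hba, hbb⟩ := exists_common_chain_length
    (fun _ hδ x => exists_hasChain_self hnw hf hconv hδ x) hδ a b
  refine topEntropy_pos_of_two_pow_le_sepNum hε hN
    (two_pow_le_sepNum hf hε hsh (p := fun s => if s then b else a) ?_ hN ?_)
  · rintro (_ | _) (_ | _) h
    all_goals first
      | exact absurd rfl h
      | (simp [dist_comm b a]; linarith)
  · rintro (_ | _) (_ | _) <;> simpa
end

section
/- Let (X,d) be a compact metric space, f : X → X a continuous map, and n ≥ 1. Then f is positively n-expansive if and only if every point of X is uniformly positively n-expansive. -/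
open Filter Topology Set
open scoped ENNReal

variable {X : Type*}

/-- `f` is positively `n`-expansive. -/
def PosNExpansive [MetricSpace X] (f : X → X) (n : ℕ) : Prop :=
  ∃ e > (0 : ℝ), ∀ y : X,
    {z : X | ∀ i : ℕ, dist (f^[i] y) (f^[i] z) < e}.encard ≤ n

/-- `x` is a uniformly positively `n`-expansive point. -/
def UnifPosNExpansivePt [MetricSpace X] (f : X → X) (n : ℕ) (x : X) : Prop :=
  ∃ U ∈ 𝓝 x, ∃ e > (0 : ℝ), ∀ y ∈ U,
    {z ∈ U | ∀ i : ℕ, dist (f^[i] y) (f^[i] z) < e}.encard ≤ n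

/-- If every point of a compact set is uniformly positively `n`-expansive, then a single
expansivity constant works for all points of that set. -/
theorem IsCompact.exists_unif_encard_le [MetricSpace X] {f : X → X} {n : ℕ} {K : Set X}
    (hK : IsCompact K) (h : ∀ x ∈ K, UnifPosNExpansivePt f n x) :
    ∃ e > (0 : ℝ), ∀ y ∈ K, {z : X | ∀ i : ℕ, dist (f^[i] y) (f^[i] z) < e}.encard ≤ n := by
  refine hK.induction_on
    (p := fun K => ∃ e > (0 : ℝ), ∀ y ∈ K,
      {z : X | ∀ i : ℕ, dist (f^[i] y) (f^[i] z) < e}.encard ≤ n)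
    ⟨1, one_pos, by simp⟩ ?_ ?_ ?_
  · rintro s t hst ⟨e, he, ht⟩
    exact ⟨e, he, fun y hy => ht y (hst hy)⟩
  · rintro s t ⟨e₁, he₁, hs⟩ ⟨e₂, he₂, ht⟩
    refine ⟨min e₁ e₂, lt_min he₁ he₂, ?_⟩
    rintro y (hy | hy)
    · exact (encard_le_encard fun z hz i => (hz i).trans_le (min_le_left _ _)).trans (hs y hy)
    · exact (encard_le_encard fun z hz i => (hz i).trans_le (min_le_right _ _)).trans (ht y hy)
  · intro x hx
    obtain ⟨U, hU, e, he, hUe⟩ := h x hx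
    obtain ⟨r, hr, hrU⟩ := Metric.mem_nhds_iff.1 hU
    refine ⟨Metric.ball x (r / 2), mem_nhdsWithin_of_mem_nhds (Metric.ball_mem_nhds x (half_pos hr)),
      min (r / 2) e, lt_min (half_pos hr) he, fun y hy => ?_⟩
    have hyU : y ∈ U := hrU (Metric.ball_subset_ball (half_le_self hr.le) hy)
    refine (encard_le_encard fun z hz => ?_).trans (hUe y hyU)
    refine ⟨hrU ?_, fun i => (hz i).trans_le (min_le_right _ _)⟩
    have hyz : dist y z < r / 2 := (hz 0).trans_le (min_le_left _ _)
    rw [Metric.mem_ball] at hy ⊢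
    linarith [dist_triangle_left z x y]

/-- Proposition: `f` is positively `n`-expansive iff every point is uniformly positively
`n`-expansive. -/
theorem stmt5 [MetricSpace X] [CompactSpace X] (f : X → X) (hf : Continuous f)
    (n : ℕ) (hn : 1 ≤ n) :
    PosNExpansive f n ↔ ∀ x : X, UnifPosNExpansivePt f n x := by
  constructor
  · rintro ⟨e, he, h⟩ x
    exact ⟨univ, univ_mem, e, he, fun y _ => (encard_le_encard fun z hz => hz.2).trans (h y)⟩
  · intro h
    obtain ⟨e, he, hK⟩ := isCompact_univ.exists_unif_encard_le fun x _ => h x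
    exact ⟨e, he, fun y => hK y (mem_univ y)⟩
end

section
/- Let (X,d) be a compact metric space and f : X → X a continuous map. Then f is positively countable-expansive if and only if every point of X is uniformly positively countable-expansive. -/
open Filter Topology Set
open scoped ENNReal

variable {X : Type*}

/-- `f` is positively countable-expansive. -/
def PosCountableExpansive [MetricSpace X] (f : X → X) : Prop :=
  ∃ e > (0 : ℝ), ∀ y : X,
    {z : X | ∀ i : ℕ, dist (f^[i] y) (f^[i] z) < e}.Countable

/-- `x` is a uniformly positively countable-expansive point. -/
def UnifPosCountableExpansivePt [MetricSpace X] (f : X → X) (x : X) : Prop :=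
  ∃ U ∈ 𝓝 x, ∃ e > (0 : ℝ), ∀ y ∈ U,
    {z ∈ U | ∀ i : ℕ, dist (f^[i] y) (f^[i] z) < e}.Countable

/-- Proposition: `f` is positively countable-expansive iff every point is uniformly positively
countable-expansive. -/
theorem stmt6 [MetricSpace X] [CompactSpace X] (f : X → X) (hf : Continuous f) :
    PosCountableExpansive f ↔ ∀ x : X, UnifPosCountableExpansivePt f x := by
  constructor
  · rintro ⟨e, he, h⟩ x
    exact ⟨univ, univ_mem, e, he, fun y _ => (h y).mono fun z hz => hz.2⟩
  · intro h
    have key : ∀ᶠ e : ℝ in 𝓝 0, ∀ y ∈ (univ : Set X),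
        {z : X | ∀ i : ℕ, dist (f^[i] y) (f^[i] z) < e}.Countable := by
      refine isCompact_univ.eventually_forall_of_forall_eventually fun x _ => ?_
      obtain ⟨U, hU, e, he, hc⟩ := h x
      obtain ⟨r, hr, hrU⟩ := Metric.mem_nhds_iff.1 hU
      filter_upwards [prod_mem_nhds (Iio_mem_nhds (lt_min he (half_pos hr)))
        (Metric.ball_mem_nhds x (half_pos hr))] with ⟨a, y⟩ ⟨ha, hy⟩
      obtain ⟨hae, har⟩ := lt_min_iff.1 (mem_Iio.1 ha)
      rw [Metric.mem_ball] at hy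
      have hyU : y ∈ U := hrU (Metric.mem_ball.2 (by linarith))
      refine Set.Countable.mono (fun z hz => ?_) (hc y hyU)
      refine ⟨hrU ?_, fun i => (hz i).trans hae⟩
      have hyz : dist y z < a := hz 0
      have hzx := dist_triangle z y x
      rw [dist_comm z y] at hzx
      exact Metric.mem_ball.2 (by linarith)
    obtain ⟨e, hP, he⟩ :=
      ((key.filter_mono nhdsWithin_le_nhds).and (self_mem_nhdsWithin (s := Ioi (0 : ℝ)))).exists
    exact ⟨e, he, fun y => hP y (mem_univ y)⟩
end

section
/- Let (X,d) be a compact metric space, f : X → X a continuous map, and let x ∈ X, e > 2b > 0, δ > 0, m ≥ 1. Suppose: (i) every δ-pseudo-orbit (x_i)_{i≥0} of f with x_0 = x is b-shadowed by some point of X; (ii) z is an accumulation point of the forward orbit {f^k(x) : k ≥ 0}; (iii) there exist two m-periodic δ-pseudo-orbits (z_i^0)_{i=0}^m and (z_i^1)_{i=0}^m with z_0^0 = z_0^1 = z_m^0 = z_m^1 = z which are e-separated, i.e. d(z_i^0, z_i^1) > e for some 0 ≤ i ≤ m. Then there exists an entropy point w of f with d(x, w) ≤ b; in particular h(f) ≥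 (log 2)/m. -/
open Filter Topology Set
open scoped ENNReal

variable {X : Type*}

/-- `w` is an entropy point of `f`: every closed neighborhood of `w` carries positive
entropy. -/
def EntropyPt [MetricSpace X] (f : X → X) (w : X) : Prop :=
  ∀ V ∈ 𝓝 w, IsClosed V → 0 < entropyWithin f V

/-- `E` is `(n, ε)`-separated for `f`. -/
def IsSepSet [MetricSpace X] (f : X → X) (n : ℕ) (ε : ℝ) (E : Finset X) : Prop :=
  ∀ x ∈ E, ∀ y ∈ E, x ≠ y → ∃ i ≤ n, ε ≤ dist (f^[i] x) (f^[i] y)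

theorem exists_card_bound_of_isSepSet [MetricSpace X] [CompactSpace X] {f : X → X}
    (hf : Continuous f) (n : ℕ) {ε : ℝ} (hε : 0 < ε) :
    ∃ B : ℕ, ∀ E : Finset X, IsSepSet f n ε E → E.card ≤ B := by
  let U : X → Set X := fun a => {y | ∀ i ∈ Finset.range (n + 1), dist (f^[i] y) (f^[i] a) < ε / 2}
  have hU : ∀ a, U a ∈ 𝓝 a := fun a => by
    refine (Filter.eventually_all_finset _).2 fun i _ => ?_
    exact ((hf.iterate i).tendsto a).eventually (Metric.ball_mem_nhds _ (half_pos hε))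
  obtain ⟨t, ht⟩ := CompactSpace.elim_nhds_subcover U hU
  refine ⟨t.card, fun E hE => ?_⟩
  have hcov : ∀ y : X, ∃ a ∈ t, y ∈ U a := fun y => by
    have : y ∈ (⊤ : Set X) := trivial
    rw [← ht] at this
    simpa using this
  choose g hgt hgU using hcov
  refine Finset.card_le_card_of_injOn g (fun y _ => hgt y) fun y hy y' hy' hyy => ?_
  by_contra hne
  obtain ⟨i, hi, hd⟩ := hE y hy y' hy' hne
  have hi' : i ∈ Finset.range (n + 1) := Finset.mem_range.2 (by omega)
  have h1 := hgU y i hi'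
  have h2 := hgU y' i hi'
  rw [← hyy] at h2
  linarith [dist_triangle_right (f^[i] y) (f^[i] y') (f^[i] (g y))]

theorem IsSepSet.card_le_sepNum [MetricSpace X] [CompactSpace X] {f : X → X}
    (hf : Continuous f) {n : ℕ} {ε : ℝ} (hε : 0 < ε) {E : Finset X} (hE : IsSepSet f n ε E)
    {V : Set X} (hV : ↑E ⊆ V) : E.card ≤ sepNum f V n ε := by
  obtain ⟨B, hB⟩ := exists_card_bound_of_isSepSet hf n hε
  refine le_csSup ⟨B, ?_⟩ ⟨E, hV, rfl, hE⟩
  rintro _ ⟨F, -, rfl, hF⟩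
  exact hB F hF

/-- Exponential growth of `sepNum`, up to a constant factor `p`, along infinitely many terms of
an arithmetic progression of times bounds the entropy from below. -/
theorem le_entropyWithin_of_frequently [MetricSpace X] {f : X → X} {V : Set X} {ε : ℝ}
    (hε : 0 < ε) {N m p : ℕ} (hm : 1 ≤ m)
    (h : ∃ᶠ n in atTop, 2 ^ n ≤ p * sepNum f V (N + n * m) ε) :
    ENNReal.ofReal (Real.log 2 / m) ≤ entropyWithin f V := by
  refine le_trans ?_ (le_iSup₂_of_le ε hε le_rfl)
  have hm' : (0 : ℝ) < m := by exact_mod_cast hm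
  have htime : Tendsto (fun n : ℕ => N + n * m) atTop atTop :=
    tendsto_atTop_mono (fun n => show n ≤ N + n * m by nlinarith) tendsto_id
  have hlim : Tendsto (fun n : ℕ => (n * Real.log 2 - Real.log p) / ((N + n * m : ℕ) : ℝ)) atTop
      (𝓝 (Real.log 2 / m)) := by
    have h1 : Tendsto (fun n : ℕ => (Real.log 2 - Real.log p / n) / ((N : ℝ) / n + m)) atTop
        (𝓝 ((Real.log 2 - 0) / (0 + m))) :=
      (tendsto_const_nhds.sub (tendsto_const_div_atTop_nhds_zero_nat _)).div
        ((tendsto_const_div_atTop_nhds_zero_nat _).add tendsto_const_nhds) (by positivity)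
    rw [sub_zero, zero_add] at h1
    refine h1.congr' ?_
    filter_upwards [eventually_ge_atTop 1] with n hn
    have hn' : (0 : ℝ) < n := by exact_mod_cast hn
    push_cast
    have : (N : ℝ) + n * m ≠ 0 := by positivity
    have : (N : ℝ) / n + m ≠ 0 := by positivity
    field_simp
  refine le_of_forall_lt fun a ha => ?_
  obtain ⟨a', haa', ha'⟩ := exists_between ha
  refine haa'.trans_le (le_limsup_of_frequently_le ?_)
  refine htime.frequently ((h.and_eventually
    ((ENNReal.tendsto_ofReal hlim).eventually_const_lt ha')).mono ?_)
  rintro n ⟨hn, hlt⟩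
  refine hlt.le.trans (ENNReal.ofReal_le_ofReal (div_le_div_of_nonneg_right ?_ (by positivity)))
  have hpos : 0 < p * sepNum f V (N + n * m) ε := lt_of_lt_of_le (by positivity) hn
  have hp : (0 : ℝ) < p := by exact_mod_cast Nat.pos_of_mul_pos_right hpos
  have hs : (0 : ℝ) < sepNum f V (N + n * m) ε := by exact_mod_cast Nat.pos_of_mul_pos_left hpos
  have hn' : (2 : ℝ) ^ n ≤ p * sepNum f V (N + n * m) ε := by exact_mod_cast hn
  have := Real.log_le_log (by positivity) hn'
  rw [Real.log_pow, Real.log_mul hp.ne' hs.ne'] at this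
  linarith

/-- A compact set containing exponentially large separated sets contains an entropy point. -/
theorem exists_entropyPt_of_isSepSet [MetricSpace X] [CompactSpace X] {f : X → X}
    (hf : Continuous f) {K : Set X} (hK : IsCompact K) {ε : ℝ} (hε : 0 < ε) {N m : ℕ}
    (hm : 1 ≤ m)
    (h : ∀ n, ∃ E : Finset X, ↑E ⊆ K ∧ E.card = 2 ^ n ∧ IsSepSet f (N + n * m) ε E) :
    ∃ w ∈ K, EntropyPt f w := by
  classical
  by_contra! hno
  simp only [EntropyPt, not_forall, not_lt, nonpos_iff_eq_zero] at hno
  choose! V hV _ hV0 using hno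
  obtain ⟨t, htK, ht⟩ := hK.elim_nhds_subcover V hV
  have key : ∀ n, ∃ w ∈ t, 2 ^ n ≤ t.card * sepNum f (V w) (N + n * m) ε := fun n => by
    obtain ⟨E, hEK, hEc, hE⟩ := h n
    have hE' : E = t.biUnion fun w => E.filter (· ∈ V w) := by
      ext y
      simp only [Finset.mem_biUnion, Finset.mem_filter]
      refine ⟨fun hy => ?_, fun ⟨_, _, hy, _⟩ => hy⟩
      obtain ⟨w, hw, hyw⟩ := mem_iUnion₂.1 (ht (hEK hy))
      exact ⟨w, hw, hy, hyw⟩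
    have hle : 2 ^ n ≤ ∑ w ∈ t, sepNum f (V w) (N + n * m) ε := by
      rw [← hEc, hE']
      refine Finset.card_biUnion_le.trans (Finset.sum_le_sum fun w _ => ?_)
      refine IsSepSet.card_le_sepNum hf hε (fun y hy y' hy' =>
        hE y (Finset.mem_of_mem_filter y hy) y' (Finset.mem_of_mem_filter y' hy')) ?_
      intro y hy
      exact (Finset.mem_filter.1 hy).2
    by_contra! hlt
    rcases t.eq_empty_or_nonempty with rfl | hne
    · simp at hle
    · have := Finset.sum_lt_sum_of_nonempty hne hlt
      rw [← Finset.mul_sum, Finset.sum_const, smul_eq_mul] at this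
      exact absurd (Nat.lt_of_mul_lt_mul_left this) hle.not_gt
  have hfreq : ∃ w ∈ t, ∃ᶠ n in atTop,
      2 ^ n ≤ t.card * sepNum f (V w) (N + n * m) ε := by
    by_contra! hcon
    obtain ⟨n, hn⟩ := ((Filter.eventually_all_finset t).2 hcon).exists
    obtain ⟨w, hw, hle⟩ := key n
    exact (hn w hw).not_ge hle
  obtain ⟨w, hw, hle⟩ := hfreq
  have hpos := le_entropyWithin_of_frequently hε hm hle
  rw [hV0 w (htK w hw), nonpos_iff_eq_zero, ENNReal.ofReal_eq_zero] at hpos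
  have : 0 < Real.log 2 / m := div_pos (Real.log_pos one_lt_two) (by exact_mod_cast hm)
  linarith

/-- The sequence following the orbit of `x` up to time `N`, then the loops `Z` of length `m` in
the order prescribed by `ω`. -/
def loopSeq (f : X → X) (x : X) (Z : Bool → ℕ → X) (N m : ℕ) (ω : ℕ → Bool) (i : ℕ) : X :=
  if i < N then f^[i] x else Z (ω ((i - N) / m)) (i - N)

theorem isPseudoOrbit_loopSeq [MetricSpace X] {f : X → X} {x z : X} {Z : Bool → ℕ → X} {δ : ℝ}
    {N m : ℕ} (hδ : 0 < δ) (hN : dist (f^[N] x) z < δ)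
    (hZ0 : ∀ a, Z a 0 = z) (hper : ∀ a, Function.Periodic (Z a) m)
    (hpo : ∀ a, IsPseudoOrbit f δ (Z a)) (ω : ℕ → Bool) :
    IsPseudoOrbit f δ (loopSeq f x Z N m ω) := by
  intro i
  unfold loopSeq
  rcases lt_trichotomy (i + 1) N with h | h | h
  · rw [if_pos (by omega), if_pos h, ← Function.iterate_succ_apply' f, dist_self]
    exact hδ
  · rw [if_pos (by omega), if_neg (by omega), ← Function.iterate_succ_apply' f, Nat.succ_eq_add_one,
      h, Nat.sub_self, hZ0]
    exact hN
  · obtain ⟨j, rfl⟩ := Nat.exists_eq_add_of_le (show N ≤ i by omega)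
    rw [if_neg (by omega), if_neg (by omega), show N + j + 1 - N = j + 1 by omega,
      Nat.add_sub_cancel_left]
    have hnext : Z (ω ((j + 1) / m)) (j + 1) = Z (ω (j / m)) (j + 1) := by
      by_cases hd : m ∣ j + 1
      · obtain ⟨k, hk⟩ := hd
        have hz : ∀ a, Z a (j + 1) = z := fun a => by
          rw [hk, mul_comm]
          simpa [hZ0 a] using (hper a).nat_mul k 0
        rw [hz, hz]
      · rw [Nat.succ_div_of_not_dvd hd]
    rw [hnext]
    exact hpo _ j

/-- Shadowing the concatenations of two loops separated by more than `2 * b` yields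
exponentially large separated sets near `x`. -/
theorem exists_isSepSet_of_loops [MetricSpace X] {f : X → X} {x z : X} {Z : Bool → ℕ → X}
    {e b δ : ℝ} {N m i : ℕ} (hm : 1 ≤ m) (he : 2 * b < e) (hδ : 0 < δ)
    (hshadow : ∀ c : ℕ → X, IsPseudoOrbit f δ c → c 0 = x → ∃ y : X, IsShadowedBy f b c y)
    (hN1 : 1 ≤ N) (hN : dist (f^[N] x) z < δ)
    (hZ0 : ∀ a, Z a 0 = z) (hper : ∀ a, Function.Periodic (Z a) m)
    (hpo : ∀ a, IsPseudoOrbit f δ (Z a)) (hi : i < m)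
    (hsep : ∀ a a', a ≠ a' → e < dist (Z a i) (Z a' i)) (n : ℕ) :
    ∃ E : Finset X, ↑E ⊆ Metric.closedBall x b ∧ E.card = 2 ^ n ∧
      IsSepSet f (N + n * m) (e - 2 * b) E := by
  classical
  have hc0 : ∀ ω, loopSeq f x Z N m ω 0 = x := fun ω => if_pos hN1
  choose y hy using fun ω => hshadow _ (isPseudoOrbit_loopSeq hδ hN hZ0 hper hpo ω) (hc0 ω)
  let Y : (Fin n → Bool) → X := fun ω => y fun k => if h : k < n then ω ⟨k, h⟩ else false
  have hYsep : ∀ ω ω', ω ≠ ω' →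
      ∃ j ≤ N + n * m, e - 2 * b < dist (f^[j] (Y ω)) (f^[j] (Y ω')) := by
    intro ω ω' hne
    obtain ⟨k, hk⟩ := Function.ne_iff.1 hne
    refine ⟨N + (k * m + i), ?_, ?_⟩
    · have : (k + 1 : ℕ) * m ≤ n * m := Nat.mul_le_mul_right m k.2
      rw [add_mul] at this
      omega
    have hc : ∀ v : ℕ → Bool, loopSeq f x Z N m v (N + (k * m + i)) = Z (v k) i := fun v => by
      have hdiv : ((k : ℕ) * m + i) / m = k := by
        rw [mul_comm, Nat.mul_add_div (by omega), Nat.div_eq_of_lt hi, add_zero]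
      rw [loopSeq, if_neg (by omega), Nat.add_sub_cancel_left, hdiv, add_comm]
      exact (hper _).nat_mul k i
    have h1 := hy (fun k => if h : k < n then ω ⟨k, h⟩ else false) (N + (k * m + i))
    have h2 := hy (fun k => if h : k < n then ω' ⟨k, h⟩ else false) (N + (k * m + i))
    rw [hc] at h1 h2
    simp only [k.2, dif_pos, Fin.eta] at h1 h2
    have h3 := hsep _ _ hk
    have h4 := dist_triangle4_left (f^[N + (k * m + i)] (Y ω)) (f^[N + (k * m + i)] (Y ω'))
      (Z (ω k) i) (Z (ω' k) i)
    have h1' : dist (f^[N + (k * m + i)] (Y ω)) (Z (ω k) i) < b := h1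
    have h2' : dist (f^[N + (k * m + i)] (Y ω')) (Z (ω' k) i) < b := h2
    linarith
  have hinj : Function.Injective Y := fun ω ω' hYY => by
    by_contra hne
    obtain ⟨j, -, hj⟩ := hYsep ω ω' hne
    rw [hYY, dist_self] at hj
    linarith
  refine ⟨Finset.univ.image Y, ?_, ?_, ?_⟩
  · intro p hp
    obtain ⟨ω, -, rfl⟩ := Finset.mem_image.1 hp
    have := hy (fun k => if h : k < n then ω ⟨k, h⟩ else false) 0
    rw [hc0] at this
    exact this.le
  · simp [Finset.card_image_of_injective _ hinj]
  · intro p hp q hq hpq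
    obtain ⟨ω, -, rfl⟩ := Finset.mem_image.1 hp
    obtain ⟨ω', -, rfl⟩ := Finset.mem_image.1 hq
    obtain ⟨j, hj, hd⟩ := hYsep ω ω' fun h => hpq (h ▸ rfl)
    exact ⟨j, hj, hd.le⟩

/-- Lemma (Kawaguchi): from a `b`-shadowable point `x`, an accumulation point `z` of its
forward orbit and an `e`-separated pair of `m`-periodic `δ`-pseudo-orbits through `z`
(with `e > 2b`), one obtains an entropy point `w` with `d(x,w) ≤ b`;
in particular `h(f) ≥ (log 2)/m`. -/
theorem stmt7 [MetricSpace X] [CompactSpace X] (f : X → X) (hf : Continuous f)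
    (x z : X) (e b δ : ℝ) (m : ℕ) (hm : 1 ≤ m)
    (hb : 0 < b) (he : 2 * b < e) (hδ : 0 < δ)
    (hshadow : ∀ c : ℕ → X, IsPseudoOrbit f δ c → c 0 = x → ∃ y : X, IsShadowedBy f b c y)
    (hacc : MapClusterPt z atTop (fun k : ℕ => f^[k] x))
    (z0 z1 : ℕ → X) (h00 : z0 0 = z) (h10 : z1 0 = z)
    (hper0 : ∀ i, z0 (i + m) = z0 i) (hper1 : ∀ i, z1 (i + m) = z1 i)
    (hpo0 : IsPseudoOrbit f δ z0) (hpo1 : IsPseudoOrbit f δ z1)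
    (hsep : ∃ i ≤ m, e < dist (z0 i) (z1 i)) :
    (∃ w : X, dist x w ≤ b ∧ EntropyPt f w) ∧
      ENNReal.ofReal (Real.log 2 / m) ≤ topEntropy f := by
  obtain ⟨i, him, hi⟩ := hsep
  have hi' : i < m := by
    refine lt_of_le_of_ne him fun him => ?_
    have h0 : z0 m = z := by simpa [h00] using hper0 0
    have h1 : z1 m = z := by simpa [h10] using hper1 0
    rw [him, h0, h1, dist_self] at hi
    linarith
  obtain ⟨N, hN, hN1⟩ := ((hacc.frequently (Metric.ball_mem_nhds z hδ)).and_eventually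
    (eventually_ge_atTop 1)).exists
  have hsepE := exists_isSepSet_of_loops (Z := fun a => bif a then z1 else z0) hm he hδ hshadow
    hN1 hN (by rintro (_ | _) <;> assumption) (by rintro (_ | _) <;> assumption)
    (by rintro (_ | _) <;> assumption) hi'
    (by
      rintro (_ | _) (_ | _) hne
      · exact absurd rfl hne
      · exact hi
      · rw [dist_comm]
        exact hi
      · exact absurd rfl hne)
  have hε : 0 < e - 2 * b := by linarith
  constructor
  · obtain ⟨w, hw, hwE⟩ := exists_entropyPt_of_isSepSet hf
      (isCompact_closedBall x b) hε hm hsepE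
    exact ⟨w, by rwa [dist_comm], hwE⟩
  · refine le_entropyWithin_of_frequently (N := N) (p := 1) hε hm (Frequently.of_forall fun n => ?_)
    obtain ⟨E, -, hEc, hE⟩ := hsepE n
    rw [one_mul, ← hEc]
    exact hE.card_le_sepNum hf hε (subset_univ _)
end

section
/- Let (X,d) be a compact metric space, f : X → X a continuous map, e ≥ 2b > 0, δ > 0, m ≥ 1, and let (z_i^0)_{i=0}^m and (z_i^1)_{i=0}^m be two m-periodic δ-pseudo-orbits through a point z ∈ X (so z_0^0 = z_0^1 = z_m^0 = z_m^1 = z) which are e-separated, i.e. d(z_i^0, z_i^1) > e for some 0 ≤ i ≤ m. For each s = (s_1, s_2, ...) ∈ Σ define the δ-pseudo-orbit γ(s) = (z_0^{s_1}, z_1^{s_1}, ..., z_{m-1}^{s_1}, z_0^{s_2}, z_1^{s_2}, ..., z_{m-1}^{s_2}, z_0^{s_3}, ...). If for every s ∈ Σ the pseudo-orbit γ(s) is b-shadowed by some point of X, then there exists a nonempty closed subset Y ⊆ X with f^m(Y) ⊆ Y, contained in the closed ball of radius b centered at z, and a continuous surjection π : Y → Σ with π ∘ f^m = σ ∘ π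 on Y (i.e., (Y, f^m|_Y) is topologically semi-conjugate to (Σ, σ)). -/
open Filter Topology Set
open scoped ENNReal

variable {X : Type*}

/-- If `A false` and `A true` are disjoint closed sets and every itinerary in `{0,1}^ℕ` with
respect to them is realized by some point, then the points whose `g`-orbit stays in their union
form a closed invariant set that factors onto the full shift. -/
theorem exists_factor_shift_of_disjoint_closed {α : Type*} [TopologicalSpace α] {g : α → α}
    (hg : Continuous g) {A : Bool → Set α} (hA : ∀ c, IsClosed (A c))
    (hdisj : Disjoint (A false) (A true))
    (hreal : ∀ s : ℕ → Bool, ∃ y, ∀ k, g^[k] y ∈ A (s k)) :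
    ∃ Y : Set α, Y.Nonempty ∧ IsClosed Y ∧ Y ⊆ ⋃ c, A c ∧
      ∃ h : MapsTo g Y Y, ∃ π : Y → (ℕ → Bool),
        Continuous π ∧ Function.Surjective π ∧
        ∀ y : Y, π ⟨g ↑y, h y.2⟩ = fun i => (π y) (i + 1) := by
  classical
  let Y : Set α := {y | ∀ k, g^[k] y ∈ ⋃ c, A c}
  let π : Y → ℕ → Bool := fun y k => decide (g^[k] y ∈ A true)
  have h : MapsTo g Y Y := fun y hy k => hy (k + 1)
  have hπ (y : Y) (k : ℕ) (c : Bool) : π y k = c ↔ g^[k] y ∈ A c := by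
    have hmem : g^[k] y ∈ A false ∨ g^[k] y ∈ A true := by
      simpa using y.2 k
    have hnot : g^[k] y ∈ A false → g^[k] y ∉ A true := fun h0 h1 =>
      Set.disjoint_left.mp hdisj h0 h1
    cases c
    · simp only [π, decide_eq_false_iff_not]
      tauto
    · simp [π]
  have hclosed (k : ℕ) (c : Bool) : IsClosed {y : Y | π y k = c} := by
    simp only [hπ]
    exact (hA c).preimage ((hg.iterate k).comp continuous_subtype_val)
  have hsurj : Function.Surjective π := by
    intro s
    obtain ⟨y, hy⟩ := hreal s
    exact ⟨⟨y, fun k => mem_iUnion.mpr ⟨s k, hy k⟩⟩, funext fun k => (hπ _ k _).mpr (hy k)⟩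
  refine ⟨Y, ?_, ?_, fun y hy => hy 0, h, π, ?_, hsurj, fun y => rfl⟩
  · obtain ⟨y, -⟩ := hsurj fun _ => true
    exact ⟨y, y.2⟩
  · simp only [Y, ofPred_forall]
    exact isClosed_iInter fun k => (isClosed_iUnion_of_finite hA).preimage (hg.iterate k)
  · refine continuous_pi fun k => (continuous_bool_rng true).mpr ⟨hclosed k true, ?_⟩
    have : (fun y => π y k) ⁻¹' {true} = {y | π y k = false}ᶜ := by
      ext y
      simp
    rw [this]
    exact (hclosed k false).isOpen_compl

/-- Lemma (Kawaguchi): given an `e`-separated pair of `m`-periodic `δ`-pseudo-orbits through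
`z` (with `e ≥ 2b > 0`) such that every concatenation `γ(s)`, `s ∈ {0,1}^ℕ`, is `b`-shadowed,
there is a nonempty closed `f^m`-invariant set `Y` inside the closed `b`-ball around `z`
which is semi-conjugate to the full shift `({0,1}^ℕ, σ)`. -/
theorem stmt8 [MetricSpace X] [CompactSpace X] (f : X → X) (hf : Continuous f)
    (z : X) (e b δ : ℝ) (m : ℕ) (hm : 1 ≤ m)
    (hb : 0 < b) (he : 2 * b ≤ e) (hδ : 0 < δ)
    (z0 z1 : ℕ → X) (h00 : z0 0 = z) (h10 : z1 0 = z)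
    (hper0 : ∀ i, z0 (i + m) = z0 i) (hper1 : ∀ i, z1 (i + m) = z1 i)
    (hpo0 : IsPseudoOrbit f δ z0) (hpo1 : IsPseudoOrbit f δ z1)
    (hsep : ∃ i ≤ m, e < dist (z0 i) (z1 i))
    (hshadow : ∀ s : ℕ → Bool, ∃ y : X, ∀ i : ℕ,
      dist (f^[i] y) ((if s (i / m) then z1 else z0) (i % m)) < b) :
    ∃ Y : Set X, Y.Nonempty ∧ IsClosed Y ∧ Y ⊆ Metric.closedBall z b ∧
      ∃ h : Set.MapsTo f^[m] Y Y, ∃ π : Y → (ℕ → Bool),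
        Continuous π ∧ Function.Surjective π ∧
        ∀ y : Y, π ⟨f^[m] ↑y, h y.2⟩ = fun i => (π y) (i + 1) := by
  have hm0 : 0 < m := hm
  have hsep' : ∃ i < m, e < dist (z0 i) (z1 i) := by
    obtain ⟨i, hi, hd⟩ := hsep
    refine ⟨i, hi.lt_of_ne ?_, hd⟩
    rintro rfl
    have h0 := hper0 0
    have h1 := hper1 0
    rw [zero_add] at h0 h1
    rw [h0, h1, h00, h10, dist_self] at hd
    linarith
  let A : Bool → Set X := fun c =>
    {x | ∀ j < m, dist (f^[j] x) ((if c then z1 else z0) j) ≤ b}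
  have hA (c : Bool) : IsClosed (A c) := by
    simp only [A, ofPred_forall]
    exact isClosed_iInter fun j => isClosed_iInter fun _ =>
      isClosed_le ((hf.iterate j).dist continuous_const) continuous_const
  have hdisj : Disjoint (A false) (A true) := by
    rw [Set.disjoint_left]
    intro x hx0 hx1
    obtain ⟨i, hi, hd⟩ := hsep'
    have h0 : dist (f^[i] x) (z0 i) ≤ b := by simpa using hx0 i hi
    have h1 : dist (f^[i] x) (z1 i) ≤ b := by simpa using hx1 i hi
    have := dist_triangle_left (z0 i) (z1 i) (f^[i] x)
    linarith
  have hreal (s : ℕ → Bool) : ∃ y, ∀ k, (f^[m])^[k] y ∈ A (s k) := by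
    obtain ⟨y, hy⟩ := hshadow s
    refine ⟨y, fun k j hj => ?_⟩
    have := hy (j + m * k)
    rw [Nat.add_mul_div_left _ _ hm0, Nat.div_eq_of_lt hj, zero_add, Nat.add_mul_mod_self_left,
      Nat.mod_eq_of_lt hj, Function.iterate_add_apply, Function.iterate_mul] at this
    exact this.le
  obtain ⟨Y, hne, hcl, hsub, hfactor⟩ :=
    exists_factor_shift_of_disjoint_closed (hf.iterate m) hA hdisj hreal
  refine ⟨Y, hne, hcl, fun y hy => ?_, hfactor⟩
  obtain ⟨c, hc⟩ := mem_iUnion.mp (hsub hy)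
  have := hc 0 hm0
  cases c <;> simpa [h00, h10] using this
end

section
/- Let X be a compact metric space and let f_n : X → X be a sequence of continuous maps converging uniformly to a map f : X → X. If the sequence (f_n) has the uniform shadowing property, then f has the shadowing property. -/
open Filter Topology Set
open scoped ENNReal

variable {X : Type*}

/-- If `F n → f` uniformly with `f` continuous and `y n → z`, then the iterates of `F n` at `y n`
converge to the iterates of `f` at `z`. -/
theorem TendstoUniformly.tendsto_iterate_apply [UniformSpace X] {ι : Type*} {l : Filter ι}
    {F : ι → X → X} {f : X → X} (hF : TendstoUniformly F f l) (hf : Continuous f)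
    {y : ι → X} {z : X} (hy : Tendsto y l (𝓝 z)) (i : ℕ) :
    Tendsto (fun n => (F n)^[i] (y n)) l (𝓝 (f^[i] z)) := by
  induction i with
  | zero => simpa using hy
  | succ i ih =>
    simp only [Function.iterate_succ_apply']
    exact hF.tendsto_comp hf.continuousAt ih

theorem IsPseudoOrbit.of_dist_lt [MetricSpace X] {f g : X → X} {δ η : ℝ} {x : ℕ → X}
    (hx : IsPseudoOrbit f δ x) (hfg : ∀ a, dist (f a) (g a) < η) :
    IsPseudoOrbit g (η + δ) x := fun i =>
  (dist_triangle_left _ _ (f (x i))).trans_lt (add_lt_add (hfg (x i)) (hx i))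

/-- Lemma: the uniform limit of a sequence of maps with the uniform shadowing property has
the shadowing property. -/
theorem stmt9 [MetricSpace X] [CompactSpace X]
    (F : ℕ → X → X) (hc : ∀ n, Continuous (F n))
    (f : X → X) (hconv : TendstoUniformly F f atTop)
    (hus : UniformShadowing F) :
    ShadowingProperty f := by
  have hf : Continuous f := hconv.continuous (Frequently.of_forall hc)
  intro ε hε
  obtain ⟨δ, hδ, hshadow⟩ := hus.2 (ε / 2) (half_pos hε)
  refine ⟨δ / 2, half_pos hδ, fun x hx => ?_⟩
  obtain ⟨N, hN⟩ := eventually_atTop.1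
    (Metric.tendstoUniformly_iff.1 hconv (δ / 2) (half_pos hδ))
  have hy : ∀ n, ∃ y, IsShadowedBy (F (n + N)) (ε / 2) x y := fun n =>
    hshadow _ x (add_halves δ ▸ hx.of_dist_lt (hN (n + N) (Nat.le_add_left N n)))
  choose y hy using hy
  obtain ⟨z, φ, hφ, hz⟩ := CompactSpace.tendsto_subseq y
  have hsub : TendstoUniformly (fun n => F (φ n + N)) f atTop := fun u hu =>
    ((tendsto_add_atTop_nat N).comp hφ.tendsto_atTop).eventually (hconv u hu)
  refine ⟨z, fun i => lt_of_le_of_lt ?_ (half_lt_self hε)⟩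
  exact le_of_tendsto ((hsub.tendsto_iterate_apply hf hz i).dist tendsto_const_nhds)
    (Eventually.of_forall fun n => (hy (φ n) i).le)
end

section
/- Let X be a compact metric space and let f_n : X → X be a sequence of continuous topologically transitive maps converging uniformly to a map f : X → X. If the sequence (f_n) has the uniform shadowing property, then f is topologically transitive. -/
open Filter Topology Set
open scoped ENNReal

variable {X : Type*}

/-- `g` is topologically transitive. -/
def TopTransitive [MetricSpace X] (g : X → X) : Prop :=
  ∀ U V : Set X, IsOpen U → IsOpen V → U.Nonempty → V.Nonempty →
    ∃ n : ℕ, 1 ≤ n ∧ (g^[n] '' U ∩ V).Nonempty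

/-- Iterates of a uniformly convergent sequence of maps converge uniformly to the iterates of the
limit, provided the limit is uniformly continuous. -/
theorem TendstoUniformly.iterate_of_uniformContinuous [MetricSpace X] {F : ℕ → X → X} {f : X → X}
    (h : TendstoUniformly F f atTop) (hf : UniformContinuous f) (k : ℕ) :
    TendstoUniformly (fun n => (F n)^[k]) f^[k] atTop := by
  rw [Metric.tendstoUniformly_iff] at h
  induction k with
  | zero =>
    rw [Metric.tendstoUniformly_iff]
    intro ε hε
    simp [hε]
  | succ k ih =>
    rw [Metric.tendstoUniformly_iff] at ih ⊢
    intro ε hε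
    obtain ⟨η, hη, hfη⟩ := Metric.uniformContinuous_iff.1 hf (ε / 2) (half_pos hε)
    filter_upwards [ih η hη, h (ε / 2) (half_pos hε)] with n hn hn' x
    rw [Function.iterate_succ_apply', Function.iterate_succ_apply']
    calc dist (f (f^[k] x)) (F n ((F n)^[k] x))
        ≤ dist (f (f^[k] x)) (f ((F n)^[k] x))
          + dist (f ((F n)^[k] x)) (F n ((F n)^[k] x)) := dist_triangle _ _ _
      _ < ε / 2 + ε / 2 := add_lt_add (hfη (hn x)) (hn' _)
      _ = ε := add_halves ε

/-- The uniform limit of topologically transitive maps with the uniform shadowing property is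
topologically transitive. -/
theorem stmt13 [MetricSpace X] [CompactSpace X]
    (F : ℕ → X → X) (hc : ∀ n, Continuous (F n))
    (htrans : ∀ n, TopTransitive (F n))
    (f : X → X) (hconv : TendstoUniformly F f atTop)
    (hus : UniformShadowing F) :
    TopTransitive f := by
  intro U V hU hV ⟨u, hu⟩ ⟨v, hv⟩
  have hf : UniformContinuous f := CompactSpace.uniformContinuous_of_continuous
    (hconv.continuous (Frequently.of_forall hc))
  obtain ⟨a, ha, haU⟩ := Metric.isOpen_iff.1 hU u hu
  obtain ⟨b, hb, hbV⟩ := Metric.isOpen_iff.1 hV v hv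
  obtain ⟨ε, hε, hεa, hεb⟩ : ∃ ε > 0, 3 * ε ≤ a ∧ 3 * ε ≤ b :=
    ⟨min a b / 3, by positivity, by linarith [min_le_left a b], by linarith [min_le_right a b]⟩
  obtain ⟨δ, hδ, hshadow⟩ := hus.2 ε hε
  have hclose := Metric.tendstoUniformly_iff.1 hconv (δ / 2) (half_pos hδ)
  obtain ⟨m, hm⟩ := hclose.exists
  obtain ⟨k, hk, _, ⟨z, hz, rfl⟩, hzV⟩ := htrans m (Metric.ball u ε) (Metric.ball v ε)
    Metric.isOpen_ball Metric.isOpen_ball ⟨u, Metric.mem_ball_self hε⟩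
    ⟨v, Metric.mem_ball_self hε⟩
  have hiter := Metric.tendstoUniformly_iff.1
    (hconv.iterate_of_uniformContinuous hf k) ε hε
  obtain ⟨n, hn, hnk⟩ := (hclose.and hiter).exists
  have hpseudo : IsPseudoOrbit (F n) δ (fun i => (F m)^[i] z) := by
    intro i
    simp only [Function.iterate_succ_apply']
    linarith [dist_triangle_left (F n ((F m)^[i] z)) (F m ((F m)^[i] z)) (f ((F m)^[i] z)),
      hn ((F m)^[i] z), hm ((F m)^[i] z)]
  obtain ⟨y, hy⟩ := hshadow n _ hpseudo
  have hyz : dist y z < ε := hy 0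
  have hyk : dist ((F n)^[k] y) ((F m)^[k] z) < ε := hy k
  rw [Metric.mem_ball] at hz hzV
  refine ⟨k, hk, f^[k] y, mem_image_of_mem _ (haU ?_), hbV ?_⟩
  · rw [Metric.mem_ball]
    linarith [dist_triangle y z u]
  · rw [Metric.mem_ball]
    linarith [hnk y, dist_triangle4 (f^[k] y) ((F n)^[k] y) ((F m)^[k] z) v]
end
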